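/- Let k ≥ 0 be an integer and let L₁, …, Lₙ be holomorphic vector fields defined on a neighborhood of 0 in ℂ^m (with n ≤ m) whose values L₁(Z), …, Lₙ(Z) are linearly independent at every point Z, and suppose there exist holomorphic functions c^s_{i,j} such that the Lie brackets satisfy [L_i, L_j](Z) = Σ_{s=1}^n c^s_{i,j}(Z) L_s(Z) + o(|Z|^k) as Z → 0, for all 1 ≤ i, j ≤ n. Then there exist holomorphic vector fields L̃₁, …, L̃ₙ on a possibly smaller neighborhood of 0 spanning at every point the same subspace of ℂ^m as L₁, …, Lₙ, and a local biholomorphic change of coordinates Z̃ = Z̃(Z) fixing 0, such that in the new coordinates L̃_i = ∂/∂Z̃_i + o(|Z̃|^{k+1}) as Z̃ → 0, for every 1 ≤ i ≤ n. -/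

import Mathlib

open Asymptotics Topology

/-- The Lie bracket of two (holomorphic) vector fields, viewed as maps `E → E`:
`[L, L'](Z) = DL'(Z)·L(Z) − DL(Z)·L'(Z)`. -/
noncomputable def lieBracketVF {E : Type*} [NormedAddCommGroup E] [NormedSpace ℂ E]
    (L L' : E → E) : E → E :=
  fun Z => fderiv ℂ L' Z (L Z) - fderiv ℂ L Z (L' Z)

section Regularity

variable {E F : Type*} [NormedAddCommGroup E] [NormedSpace ℂ E]
  [NormedAddCommGroup F] [NormedSpace ℂ F]

/-- Cauchy's estimate for the Fréchet derivative, with a non-optimal constant. -/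
theorem norm_fderiv_le_of_forall_mem_ball {f : E → F} {x : E} {r M : ℝ} (hr : 0 < r)
    (hf : DifferentiableOn ℂ f (Metric.ball x r)) (hM : ∀ z ∈ Metric.ball x r, ‖f z‖ ≤ M) :
    ‖fderiv ℂ f x‖ ≤ 2 * M / r := by
  have hx : x ∈ Metric.ball x r := Metric.mem_ball_self hr
  have hM0 : 0 ≤ M := (norm_nonneg _).trans (hM x hx)
  have hfx : DifferentiableAt ℂ f x := hf.differentiableAt (Metric.ball_mem_nhds x hr)
  refine ContinuousLinearMap.opNorm_le_bound _ (by positivity) fun h => ?_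
  rcases eq_or_ne h 0 with rfl | hh
  · simp
  have hh' : 0 < ‖h‖ := norm_pos_iff.2 hh
  set R : ℝ := r / (2 * ‖h‖) with hR
  have hR0 : 0 < R := by positivity
  have hmem : ∀ s ∈ Metric.closedBall (0 : ℂ) R, x + s • h ∈ Metric.ball x r := by
    intro s hs
    rw [mem_closedBall_zero_iff] at hs
    rw [mem_ball_iff_norm, add_sub_cancel_left, norm_smul]
    calc ‖s‖ * ‖h‖ ≤ R * ‖h‖ := by gcongr
      _ = r / 2 := by rw [hR]; field_simp
      _ < r := by linarith
  have hd : DiffContOnCl ℂ (fun s : ℂ => f (x + s • h)) (Metric.ball 0 R) := by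
    apply DifferentiableOn.diffContOnCl
    rw [closure_ball _ hR0.ne']
    exact hf.comp (by fun_prop) hmem
  have hder : HasDerivAt (fun s : ℂ => f (x + s • h)) (fderiv ℂ f x h) 0 :=
    hfx.hasFDerivAt.hasLineDerivAt h
  have := Complex.norm_deriv_le_of_forall_mem_sphere_norm_le hR0 hd
    (fun z hz => hM _ (hmem z (Metric.sphere_subset_closedBall hz)))
  rw [hder.deriv] at this
  refine this.trans_eq ?_
  rw [hR]
  field_simp

/-- The derivative of a holomorphic function is continuous. -/
theorem continuousOn_fderiv_of_differentiableOn {f : E → F} {U : Set E} (hU : IsOpen U)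
    (hf : DifferentiableOn ℂ f U) : ContinuousOn (fderiv ℂ f) U := by
  intro x hx
  apply ContinuousAt.continuousWithinAt
  have hfx : ContinuousAt f x := (hf.differentiableAt (hU.mem_nhds hx)).continuousAt
  have hev : ∀ᶠ z in 𝓝 x, z ∈ U ∧ ‖f z‖ < ‖f x‖ + 1 :=
    (hU.eventually_mem hx).and (hfx.norm.eventually_lt_const (by linarith))
  obtain ⟨r, hr, hrb⟩ := Metric.eventually_nhds_iff_ball.1 hev
  set M := ‖f x‖ + 1
  have hsub : ∀ {y : E} {ρ : ℝ}, dist y x + ρ ≤ r → Metric.ball y ρ ⊆ Metric.ball x r := by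
    intro y ρ h
    exact Metric.ball_subset_ball' (by linarith)
  have hdiff : ∀ y ∈ Metric.ball x r, DifferentiableAt ℂ f y := fun y hy =>
    hf.differentiableAt (hU.mem_nhds (hrb y hy).1)
  have hbd : ∀ y ∈ Metric.ball x (r / 2), ‖fderiv ℂ f y‖ ≤ 2 * M / (r / 2) := by
    intro y hy
    have hs : Metric.ball y (r / 2) ⊆ Metric.ball x r := hsub (by
      rw [Metric.mem_ball] at hy; linarith)
    exact norm_fderiv_le_of_forall_mem_ball (by positivity)
      (fun z hz => (hdiff z (hs hz)).differentiableWithinAt)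
      (fun z hz => (hrb z (hs hz)).2.le)
  set C := 2 * M / (r / 2)
  have hlip : ∀ y ∈ Metric.ball x (r / 4),
      dist (fderiv ℂ f y) (fderiv ℂ f x) ≤ 2 * (C * dist y x) / (r / 4) := by
    intro y hy
    rw [Metric.mem_ball] at hy
    have hin : ∀ z ∈ Metric.ball x (r / 4), z + (y - x) ∈ Metric.ball x (r / 2) := by
      intro z hz
      rw [mem_ball_iff_norm] at hz ⊢
      rw [dist_eq_norm] at hy
      calc ‖z + (y - x) - x‖ = ‖(z - x) + (y - x)‖ := by congr 1; abel
        _ ≤ _ := norm_add_le _ _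
        _ < r / 2 := by linarith
    have hle : Metric.ball x (r / 2) ⊆ Metric.ball x r := Metric.ball_subset_ball (by linarith)
    have hle' : Metric.ball x (r / 4) ⊆ Metric.ball x (r / 2) :=
      Metric.ball_subset_ball (by linarith)
    have hd1 : ∀ z ∈ Metric.ball x (r / 4), DifferentiableAt ℂ (fun z => f (z + (y - x))) z :=
      fun z hz => (hdiff _ (hle (hin z hz))).comp z (by fun_prop)
    have key := norm_fderiv_le_of_forall_mem_ball (f := fun z => f (z + (y - x)) - f z) (x := x)
      (r := r / 4) (M := C * dist y x) (by positivity)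
      (fun z hz => ((hd1 z hz).sub (hdiff z (hle (hle' hz)))).differentiableWithinAt)
      (fun z hz => by
        have := (convex_ball x (r / 2)).norm_image_sub_le_of_norm_fderiv_le (𝕜 := ℂ)
          (fun w hw => hdiff w (hle hw)) hbd (hle' hz) (hin z hz)
        simpa [dist_eq_norm] using this)
    have hx4 : x ∈ Metric.ball x (r / 4) := Metric.mem_ball_self (by positivity)
    rw [fderiv_fun_sub (hd1 x hx4) (hdiff x (hle (hle' hx4))), fderiv_comp_add_right] at key
    simpa [dist_eq_norm] using key
  rw [ContinuousAt, tendsto_iff_dist_tendsto_zero]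
  refine squeeze_zero' (Filter.Eventually.of_forall fun _ => dist_nonneg)
    (Filter.eventually_of_mem (Metric.ball_mem_nhds x (by positivity)) hlip) ?_
  have : Continuous fun y => 2 * (C * dist y x) / (r / 4) := by fun_prop
  simpa using this.tendsto x

theorem ContinuousOn.uncurry_section {X Y G : Type*} [TopologicalSpace X] [TopologicalSpace Y]
    [TopologicalSpace G] {Ψ : X → Y → G} {W : Set (X × Y)} {x : X} {K : Set Y}
    (hΨ : ContinuousOn (Function.uncurry Ψ) W) (hx : ∀ t ∈ K, (x, t) ∈ W) :
    ContinuousOn (Ψ x) K :=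
  hΨ.comp (f := fun t => (x, t)) (by fun_prop) hx

/-- Differentiation under the integral sign for a jointly continuous integrand. -/
theorem hasFDerivAt_intervalIntegral_of_continuousOn {Φ : E → ℝ → F}
    {Φ' : E → ℝ → E →L[ℂ] F} {x : E} {a b : ℝ} {W : Set (E × ℝ)} (hW : IsOpen W)
    (hxW : ∀ t ∈ Set.uIcc a b, (x, t) ∈ W) (hΦ : ContinuousOn (Function.uncurry Φ) W)
    (hΦ' : ContinuousOn (Function.uncurry Φ') W)
    (hd : ∀ z t, (z, t) ∈ W → HasFDerivAt (fun z => Φ z t) (Φ' z t) z) :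
    HasFDerivAt (fun z => ∫ t in a..b, Φ z t) (∫ t in a..b, Φ' x t) x := by
  obtain ⟨M, hM⟩ := isCompact_uIcc.exists_bound_of_continuousOn (hΦ'.uncurry_section hxW)
  have hev : ∀ᶠ z in 𝓝 x, ∀ t ∈ Set.uIcc a b, (z, t) ∈ W ∧ ‖Φ' z t‖ < M + 1 := by
    refine isCompact_uIcc.eventually_forall_of_forall_eventually fun t ht => ?_
    refine (hW.eventually_mem (hxW t ht)).and ?_
    have := (hΦ'.continuousAt (hW.mem_nhds (hxW t ht))).norm
    exact this.eventually_lt_const (by simpa using (hM t ht).trans_lt (lt_add_one M))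
  refine intervalIntegral.hasFDerivAt_integral_of_dominated_of_fderiv_le (bound := fun _ => M + 1)
    hev ?_ (hΦ.uncurry_section hxW).intervalIntegrable
    (((hΦ'.uncurry_section hxW).mono Set.uIoc_subset_uIcc).aestronglyMeasurable measurableSet_uIoc)
    ?_ (by simp) ?_
  · filter_upwards [hev] with z hz
    exact ((hΦ.uncurry_section fun t ht => (hz t ht).1).mono
      Set.uIoc_subset_uIcc).aestronglyMeasurable measurableSet_uIoc
  · exact Filter.Eventually.of_forall fun t ht z hz =>
      (hz t (Set.uIoc_subset_uIcc ht)).2.le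
  · exact Filter.Eventually.of_forall fun t ht z hz =>
      hd z t (hz t (Set.uIoc_subset_uIcc ht)).1

/-- Directional derivatives of a holomorphic function are holomorphic. -/
theorem differentiableOn_fderiv_apply [CompleteSpace F] {f : E → F} {U : Set E} (hU : IsOpen U)
    (hf : DifferentiableOn ℂ f U) (h : E) : DifferentiableOn ℂ (fun z => fderiv ℂ f z h) U := by
  intro x hx
  apply DifferentiableAt.differentiableWithinAt
  obtain ⟨ρ, hρ, hball⟩ := Metric.isOpen_iff.1 hU x hx
  set R : ℝ := ρ / (2 * (‖h‖ + 1)) with hR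
  have hR0 : 0 < R := by positivity
  have hmem : ∀ z ∈ Metric.ball x (ρ / 2), ∀ s ∈ Metric.closedBall (0 : ℂ) R, z + s • h ∈ U := by
    intro z hz s hs
    apply hball
    rw [mem_closedBall_zero_iff] at hs
    rw [mem_ball_iff_norm] at hz ⊢
    have h1 : ‖s • h‖ ≤ ρ / 2 := by
      rw [norm_smul]
      calc ‖s‖ * ‖h‖ ≤ R * (‖h‖ + 1) := by gcongr; linarith
        _ = ρ / 2 := by rw [hR]; field_simp
    calc ‖z + s • h - x‖ = ‖(z - x) + s • h‖ := by congr 1; abel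
      _ ≤ ‖z - x‖ + ‖s • h‖ := norm_add_le _ _
      _ < ρ := by linarith
  set w : ℝ → ℂ := fun θ => deriv (circleMap 0 R) θ * (1 / (circleMap 0 R θ - 0) ^ 2) with hw
  have hwc : Continuous w := by
    have : Continuous fun θ : ℝ => 1 / (circleMap 0 R θ - 0) ^ 2 := by
      refine continuous_const.div (by fun_prop) fun θ => ?_
      simpa using hR0.ne'
    simp only [hw, deriv_circleMap]
    fun_prop
  have hrep : (fun z => fderiv ℂ f z h) =ᶠ[𝓝 x] fun z => (2 * Real.pi * Complex.I : ℂ)⁻¹ •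
      ∫ θ in 0..2 * Real.pi, w θ • f (z + circleMap 0 R θ • h) := by
    filter_upwards [Metric.ball_mem_nhds x (half_pos hρ)] with z hz
    have hzU : z ∈ U := by simpa using hmem z hz 0 (by simpa using hR0.le)
    have hder : HasDerivAt (fun s : ℂ => f (z + s • h)) (fderiv ℂ f z h) 0 :=
      (hf.differentiableAt (hU.mem_nhds hzU)).hasFDerivAt.hasLineDerivAt h
    have hd : DifferentiableOn ℂ (fun s : ℂ => f (z + s • h)) (Metric.closedBall 0 R) :=
      hf.comp (by fun_prop) (hmem z hz)
    rw [eq_inv_smul_iff₀ Complex.two_pi_I_ne_zero, ← hder.deriv,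
      ← hd.deriv_eq_smul_circleIntegral hR0]
    simp only [circleIntegral, hw, mul_smul]
  refine DifferentiableAt.congr_of_eventuallyEq ?_ hrep
  refine DifferentiableAt.const_smul ?_ _
  have hshift : Continuous fun p : E × ℝ => p.1 + circleMap 0 R p.2 • h := by fun_prop
  have hW := hU.preimage hshift
  refine (hasFDerivAt_intervalIntegral_of_continuousOn hW
    (Φ' := fun z θ => w θ • fderiv ℂ f (z + circleMap 0 R θ • h)) ?_ ?_ ?_ ?_).differentiableAt
  · intro t _
    exact hmem x (Metric.mem_ball_self (half_pos hρ)) _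
      (Metric.sphere_subset_closedBall (circleMap_mem_sphere 0 hR0.le t))
  · exact (hwc.comp continuous_snd).continuousOn.smul
      (hf.continuousOn.comp hshift.continuousOn fun _ hp => hp)
  · exact (hwc.comp continuous_snd).continuousOn.smul
      ((continuousOn_fderiv_of_differentiableOn hU hf).comp hshift.continuousOn fun _ hp => hp)
  · intro z t hzt
    have := (hf.differentiableAt (hU.mem_nhds hzt)).hasFDerivAt.comp z
      ((hasFDerivAt_id (𝕜 := ℂ) z).add_const (circleMap 0 R t • h))
    exact this.const_smul (w t)

/-- A holomorphic function on an open subset of a finite-dimensional space is smooth. -/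
theorem contDiffOn_of_differentiableOn_complex [FiniteDimensional ℂ E] [CompleteSpace F]
    {f : E → F} {U : Set E} (hU : IsOpen U) (hf : DifferentiableOn ℂ f U) (n : ℕ) :
    ContDiffOn ℂ n f U := by
  induction n generalizing f with
  | zero => exact contDiffOn_zero.2 hf.continuousOn
  | succ n ih =>
    push_cast
    rw [contDiffOn_succ_iff_fderiv_of_isOpen hU]
    refine ⟨hf, by simp, contDiffOn_clm_apply.2 fun h => ?_⟩
    exact ih (differentiableOn_fderiv_apply hU hf h)

theorem eventually_contDiffAt_of_eventually_differentiableAt [FiniteDimensional ℂ E]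
    [CompleteSpace F] {f : E → F} {x : E} (hf : ∀ᶠ z in 𝓝 x, DifferentiableAt ℂ f z) (n : ℕ) :
    ∀ᶠ z in 𝓝 x, ContDiffAt ℂ n f z := by
  obtain ⟨U, hUf, hU, hxU⟩ := eventually_nhds_iff.1 hf
  filter_upwards [hU.mem_nhds hxU] with z hz
  exact (contDiffOn_of_differentiableOn_complex hU
    (fun y hy => (hUf y hy).differentiableWithinAt) n).contDiffAt (hU.mem_nhds hz)

end Regularity

section Poincare

variable {E F : Type*} [NormedAddCommGroup E] [NormedSpace ℂ E]
  [NormedAddCommGroup F] [NormedSpace ℂ F]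

/-- Cauchy's estimate: differentiating a holomorphic `o(‖Z‖ ^ r)` loses one order. -/
theorem isLittleO_norm_mul_norm_fderiv {g : E → F} (hg : ∀ᶠ Z in 𝓝 0, DifferentiableAt ℂ g Z)
    {r : ℕ} (h : g =o[𝓝 0] fun Z => ‖Z‖ ^ r) :
    (fun Z => ‖Z‖ * ‖fderiv ℂ g Z‖) =o[𝓝 0] fun Z => ‖Z‖ ^ r := by
  rw [isLittleO_iff] at h ⊢
  intro c hc
  obtain ⟨δ, hδ, hball⟩ := Metric.eventually_nhds_iff_ball.1
    (hg.and (h (c := c / (2 * 2 ^ r)) (by positivity)))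
  filter_upwards [Metric.ball_mem_nhds 0 (half_pos hδ)] with Z hZ
  rw [mem_ball_zero_iff] at hZ
  rw [norm_mul, norm_norm, norm_norm]
  rcases eq_or_ne Z 0 with rfl | hZ0
  · simp only [norm_zero, zero_mul]
    positivity
  have hZ' : 0 < ‖Z‖ := norm_pos_iff.2 hZ0
  have hle : ∀ z ∈ Metric.ball Z ‖Z‖, ‖z‖ ≤ 2 * ‖Z‖ := by
    intro z hz
    rw [mem_ball_iff_norm] at hz
    calc ‖z‖ = ‖(z - Z) + Z‖ := by rw [sub_add_cancel]
      _ ≤ ‖z - Z‖ + ‖Z‖ := norm_add_le _ _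
      _ ≤ 2 * ‖Z‖ := by linarith
  have hin : ∀ z ∈ Metric.ball Z ‖Z‖, z ∈ Metric.ball 0 δ := fun z hz => by
    rw [mem_ball_zero_iff]
    linarith [hle z hz]
  have := norm_fderiv_le_of_forall_mem_ball (f := g) (M := c / (2 * 2 ^ r) * (2 * ‖Z‖) ^ r) hZ'
    (fun z hz => (hball z (hin z hz)).1.differentiableWithinAt)
    (fun z hz => by
      refine (hball z (hin z hz)).2.trans ?_
      rw [norm_pow, norm_norm]
      gcongr
      exact hle z hz)
  calc ‖Z‖ * ‖fderiv ℂ g Z‖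
      ≤ ‖Z‖ * (2 * (c / (2 * 2 ^ r) * (2 * ‖Z‖) ^ r) / ‖Z‖) := by gcongr
    _ = c * ‖‖Z‖ ^ r‖ := by rw [norm_pow, norm_norm, mul_pow]; field_simp

/-- For `P` a projection, the deformation `retraction P t`, `t ∈ [0, 1]`, joins `id - P` to the
identity. -/
noncomputable def retraction (P : E →L[ℂ] E) (t : ℝ) : E →L[ℂ] E :=
  ContinuousLinearMap.id ℂ E - (1 - (t : ℂ)) • P

theorem retraction_apply (P : E →L[ℂ] E) (t : ℝ) (x : E) :
    retraction P t x = x - (1 - (t : ℂ)) • P x := rfl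

theorem continuous_retraction (P : E →L[ℂ] E) : Continuous (retraction P) := by
  unfold retraction
  fun_prop

theorem norm_retraction_apply_le (P : E →L[ℂ] E) {t : ℝ} (ht : t ∈ Set.Icc (0 : ℝ) 1) (x : E) :
    ‖retraction P t x‖ ≤ (1 + ‖P‖) * ‖x‖ := by
  have h1 : ‖(1 - (t : ℂ))‖ ≤ 1 := by
    rw [← Complex.ofReal_one, ← Complex.ofReal_sub, Complex.norm_real, Real.norm_eq_abs, abs_le]
    constructor <;> linarith [ht.1, ht.2]
  calc ‖retraction P t x‖ ≤ ‖x‖ + ‖(1 - (t : ℂ)) • P x‖ := norm_sub_le _ _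
    _ ≤ ‖x‖ + 1 * (‖P‖ * ‖x‖) := by
      rw [norm_smul]
      gcongr
      exact P.le_opNorm x
    _ = (1 + ‖P‖) * ‖x‖ := by ring

theorem eventually_forall_retraction {P : E →L[ℂ] E} {p : E → Prop} (hp : ∀ᶠ x in 𝓝 0, p x) :
    ∀ᶠ x in 𝓝 0, ∀ t ∈ Set.Icc (0 : ℝ) 1, p (retraction P t x) := by
  obtain ⟨δ, hδ, hball⟩ := Metric.eventually_nhds_iff_ball.1 hp
  filter_upwards [Metric.ball_mem_nhds (0 : E) (show 0 < δ / (1 + ‖P‖) by positivity)] with x hx t ht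
  rw [mem_ball_zero_iff, lt_div_iff₀ (by positivity)] at hx
  refine hball _ (mem_ball_zero_iff.2 ((norm_retraction_apply_le P ht x).trans_lt ?_))
  linarith

theorem isLittleO_integral_of_norm_le_retraction {G : Type*} [NormedAddCommGroup G]
    {P : E →L[ℂ] E} {φ : E → G} {ψ : E → ℝ → F}
    {r : ℕ} (hφ : φ =o[𝓝 0] fun x => ‖x‖ ^ r)
    (hψ : ∀ x, ∀ t ∈ Set.Icc (0 : ℝ) 1, ‖ψ x t‖ ≤ ‖φ (retraction P t x)‖) :
    (fun x => ∫ t in (0 : ℝ)..1, ψ x t) =o[𝓝 0] fun x => ‖x‖ ^ r := by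
  rw [isLittleO_iff] at hφ ⊢
  intro c hc
  filter_upwards [eventually_forall_retraction (P := P)
    (hφ (c := c / (1 + ‖P‖) ^ r) (by positivity))] with x hx
  have : ∀ t ∈ Set.uIoc (0 : ℝ) 1, ‖ψ x t‖ ≤ c * ‖x‖ ^ r := by
    intro t ht
    rw [Set.uIoc_of_le zero_le_one] at ht
    have ht' := Set.Ioc_subset_Icc_self ht
    calc ‖ψ x t‖ ≤ c / (1 + ‖P‖) ^ r * ‖‖retraction P t x‖ ^ r‖ := (hψ x t ht').trans (hx t ht')
      _ ≤ c / (1 + ‖P‖) ^ r * ((1 + ‖P‖) * ‖x‖) ^ r := by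
        rw [norm_pow, norm_norm]
        gcongr
        exact norm_retraction_apply_le P ht' x
      _ = c * ‖x‖ ^ r := by rw [mul_pow]; field_simp
  simpa using intervalIntegral.norm_integral_le_of_norm_le_const this

theorem hasFDerivAt_integral_comp_retraction {P : E →L[ℂ] E} {g : E → F} {U : Set E}
    (hU : IsOpen U) (hg : DifferentiableOn ℂ g U) {x : E}
    (hx : ∀ t ∈ Set.Icc (0 : ℝ) 1, retraction P t x ∈ U) :
    HasFDerivAt (fun z => ∫ t in (0 : ℝ)..1, g (retraction P t z))
      (∫ t in (0 : ℝ)..1, (fderiv ℂ g (retraction P t x)).comp (retraction P t)) x := by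
  have hc : Continuous fun p : E × ℝ => retraction P p.2 p.1 :=
    ((continuous_retraction P).comp continuous_snd).clm_apply continuous_fst
  refine hasFDerivAt_intervalIntegral_of_continuousOn (hU.preimage hc)
    (Φ' := fun z t => (fderiv ℂ g (retraction P t z)).comp (retraction P t)) ?_ ?_ ?_ ?_
  · simpa [Set.uIcc_of_le] using hx
  · exact hg.continuousOn.comp hc.continuousOn fun _ hp => hp
  · exact ((continuousOn_fderiv_of_differentiableOn hU hg).comp hc.continuousOn
      fun _ hp => hp).clm_comp ((continuous_retraction P).comp continuous_snd).continuousOn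
  · intro z t hzt
    exact (hg.differentiableAt (hU.mem_nhds hzt)).hasFDerivAt.comp z
      (retraction P t).hasFDerivAt

theorem continuousOn_fderiv_comp_retraction {P : E →L[ℂ] E} {g : E → F} {U : Set E}
    (hU : IsOpen U) (hg : DifferentiableOn ℂ g U) {x : E}
    (hx : ∀ t ∈ Set.Icc (0 : ℝ) 1, retraction P t x ∈ U) :
    ContinuousOn (fun t => fderiv ℂ g (retraction P t x)) (Set.uIcc 0 1) := by
  rw [Set.uIcc_of_le zero_le_one]
  exact (continuousOn_fderiv_of_differentiableOn hU hg).comp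
    ((continuous_retraction P).clm_apply continuous_const).continuousOn hx

theorem integral_add_smul_fderiv_retraction [CompleteSpace F] {P : E →L[ℂ] E} {g : E → F}
    {U : Set E} (hU : IsOpen U) (hg : DifferentiableOn ℂ g U) {x : E}
    (hx : ∀ t ∈ Set.Icc (0 : ℝ) 1, retraction P t x ∈ U) :
    ∫ t in (0 : ℝ)..1, (g (retraction P t x) +
      (t : ℂ) • fderiv ℂ g (retraction P t x) (P x)) = g x := by
  have hS : ∀ t : ℝ, HasDerivAt (fun t => retraction P t x) (P x) t := by
    intro t
    have h1 : HasDerivAt (fun t : ℝ => (1 - (t : ℂ))) (-1) t := by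
      simpa using (Complex.ofRealCLM.hasDerivAt (x := t)).const_sub (1 : ℂ)
    simpa [retraction_apply] using (h1.smul_const (P x)).const_sub x
  have hder : ∀ t ∈ Set.uIcc (0 : ℝ) 1, HasDerivAt (fun t : ℝ => (t : ℂ) • g (retraction P t x))
      (g (retraction P t x) + (t : ℂ) • fderiv ℂ g (retraction P t x) (P x)) t := by
    intro t ht
    rw [Set.uIcc_of_le zero_le_one] at ht
    have h1 : HasDerivAt (fun t : ℝ => (t : ℂ)) 1 t := by
      simpa using (hasDerivAt_id t).ofReal_comp
    have h2 := ((hg.differentiableAt (hU.mem_nhds (hx t ht))).hasFDerivAt.restrictScalars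
      ℝ).comp_hasDerivAt t (hS t)
    exact (h1.smul h2).congr_deriv (by simp [add_comm])
  have hcont : ContinuousOn (fun t : ℝ => g (retraction P t x)) (Set.uIcc 0 1) := by
    rw [Set.uIcc_of_le zero_le_one]
    exact hg.continuousOn.comp
      ((continuous_retraction P).clm_apply continuous_const).continuousOn hx
  rw [intervalIntegral.integral_eq_sub_of_hasDerivAt hder]
  · simp [retraction_apply]
  · refine (hcont.add ?_).intervalIntegrable
    exact Complex.continuous_ofReal.continuousOn.smul
      ((continuousOn_fderiv_comp_retraction hU hg hx).clm_apply continuousOn_const)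

/-- A Poincaré lemma up to higher order errors: functions `g i` vanishing to order `r` whose mixed
derivatives along the independent vectors `v i` agree to order `r` are, to order `r + 1`, the
derivatives of a single function along these vectors. -/
theorem exists_fderiv_apply_sub_isLittleO [CompleteSpace F] {ι : Type*} [Fintype ι] [DecidableEq ι]
    {v : ι → E} {ζ : ι → E →L[ℂ] ℂ} (hζ : ∀ i j, ζ i (v j) = if i = j then 1 else 0)
    {g : ι → E → F} {r : ℕ} (hg : ∀ i, ∀ᶠ x in 𝓝 0, DifferentiableAt ℂ (g i) x)
    (hgo : ∀ i, g i =o[𝓝 0] fun x => ‖x‖ ^ r)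
    (hclosed : ∀ i j, (fun x => fderiv ℂ (g j) x (v i) - fderiv ℂ (g i) x (v j))
      =o[𝓝 0] fun x => ‖x‖ ^ r) :
    ∃ q : E → F, (∀ᶠ x in 𝓝 0, DifferentiableAt ℂ q x) ∧ (q =o[𝓝 0] fun x => ‖x‖ ^ (r + 1)) ∧
      ∀ i, (fun x => fderiv ℂ q x (v i) - g i x) =o[𝓝 0] fun x => ‖x‖ ^ (r + 1) := by
  set P : E →L[ℂ] E := ∑ j, (ζ j).smulRight (v j) with hP
  have hPapply : ∀ x, P x = ∑ j, ζ j x • v j := fun x => by simp [hP]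
  have hPv : ∀ i, P (v i) = v i := fun i => by simp [hPapply, hζ]
  have hSv : ∀ (t : ℝ) i, retraction P t (v i) = (t : ℂ) • v i := fun t i => by
    rw [retraction_apply, hPv, sub_smul, one_smul, sub_sub_cancel]
  obtain ⟨U, hUg, hU, h0U⟩ := eventually_nhds_iff.1 (Filter.eventually_all.2 hg)
  have hgU : ∀ i, DifferentiableOn ℂ (g i) U := fun i x hx => (hUg x hx i).differentiableWithinAt
  set G : ι → E → F := fun j x => ∫ t in (0 : ℝ)..1, g j (retraction P t x) with hG
  have hxU : ∀ᶠ x in 𝓝 0, ∀ t ∈ Set.Icc (0 : ℝ) 1, retraction P t x ∈ U :=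
    eventually_forall_retraction (hU.mem_nhds h0U)
  have hζO : ∀ j, (fun x => ζ j x) =O[𝓝 0] fun x => ‖x‖ := fun j => (ζ j).isBigO_id _ |>.norm_right
  have hpow : ∀ {φ : E → F} (j : ι), (φ =o[𝓝 0] fun x => ‖x‖ ^ r) →
      (fun x => ζ j x • φ x) =o[𝓝 0] fun x => ‖x‖ ^ (r + 1) := fun j hφ => by
    simpa only [pow_succ', smul_eq_mul] using (hζO j).smul_isLittleO hφ
  have hGo : ∀ j, G j =o[𝓝 0] fun x => ‖x‖ ^ r := fun j =>
    isLittleO_integral_of_norm_le_retraction (hgo j) fun _ _ _ => le_rfl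
  have hqder : ∀ x, (∀ t ∈ Set.Icc (0 : ℝ) 1, retraction P t x ∈ U) →
      HasFDerivAt (fun x => ∑ j, ζ j x • G j x)
        (∑ j, (ζ j x • (∫ t in (0 : ℝ)..1,
          (fderiv ℂ (g j) (retraction P t x)).comp (retraction P t)) +
          (ζ j).smulRight (G j x))) x := fun x hx =>
    HasFDerivAt.fun_sum fun j _ =>
      (ζ j).hasFDerivAt.smul (hasFDerivAt_integral_comp_retraction hU (hgU j) hx)
  refine ⟨fun x => ∑ j, ζ j x • G j x, ?_, ?_, fun i => ?_⟩
  · filter_upwards [hxU] with x hx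
    exact (hqder x hx).differentiableAt
  · exact IsLittleO.fun_sum fun j _ => hpow j (hGo j)
  · have hmain : (fun x => ∑ j, ζ j x • ∫ t in (0 : ℝ)..1, (t : ℂ) •
        (fderiv ℂ (g j) (retraction P t x) (v i) - fderiv ℂ (g i) (retraction P t x) (v j)))
        =o[𝓝 0] fun x => ‖x‖ ^ (r + 1) := by
      refine IsLittleO.fun_sum fun j _ => hpow j ?_
      refine isLittleO_integral_of_norm_le_retraction (P := P) (hclosed i j) fun x t ht => ?_
      rw [norm_smul, Complex.norm_real, Real.norm_of_nonneg ht.1]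
      exact mul_le_of_le_one_left (norm_nonneg _) ht.2
    refine hmain.congr' ?_ Filter.EventuallyEq.rfl
    filter_upwards [hxU] with x hx
    have hcv : ∀ j w, ContinuousOn (fun t : ℝ => (t : ℂ) • fderiv ℂ (g j) (retraction P t x) w)
        (Set.uIcc 0 1) := fun j w => Complex.continuous_ofReal.continuousOn.smul
      ((continuousOn_fderiv_comp_retraction hU (hgU j) hx).clm_apply continuousOn_const)
    have hgc : ContinuousOn (fun t : ℝ => g i (retraction P t x)) (Set.uIcc 0 1) := by
      rw [Set.uIcc_of_le zero_le_one]
      exact (hgU i).continuousOn.comp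
        ((continuous_retraction P).clm_apply continuous_const).continuousOn hx
    have hint : ∀ j, (∫ t in (0 : ℝ)..1,
        (fderiv ℂ (g j) (retraction P t x)).comp (retraction P t)) (v i) =
        ∫ t in (0 : ℝ)..1, (t : ℂ) • fderiv ℂ (g j) (retraction P t x) (v i) := by
      intro j
      rw [ContinuousLinearMap.intervalIntegral_apply]
      · simp [hSv]
      · exact ((continuousOn_fderiv_comp_retraction hU (hgU j) hx).clm_comp
          (continuous_retraction P).continuousOn).intervalIntegrable
    have hgi : g i x = G i x +
        ∑ j, ζ j x • ∫ t in (0 : ℝ)..1, (t : ℂ) • fderiv ℂ (g i) (retraction P t x) (v j) := by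
      rw [← integral_add_smul_fderiv_retraction hU (hgU i) hx,
        intervalIntegral.integral_add hgc.intervalIntegrable (hcv i (P x)).intervalIntegrable]
      congr 1
      simp_rw [← intervalIntegral.integral_smul]
      rw [← intervalIntegral.integral_finsetSum]
      · refine intervalIntegral.integral_congr fun t _ => ?_
        simp only [hPapply, map_sum, map_smul, Finset.smul_sum]
        exact Finset.sum_congr rfl fun j _ => smul_comm _ _ _
      · exact fun j _ => ((hcv i (v j)).const_smul (ζ j x)).intervalIntegrable
    rw [(hqder x hx).fderiv, hgi]
    simp only [sum_apply, add_apply,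
      smul_apply, hint, ContinuousLinearMap.smulRight_apply, hζ,
      Finset.sum_add_distrib, ite_smul, one_smul, zero_smul, Finset.sum_ite_eq', Finset.mem_univ,
      if_true, smul_sub]
    simp_rw [intervalIntegral.integral_sub (hcv _ (v i)).intervalIntegrable
      (hcv i (v _)).intervalIntegrable, smul_sub]
    rw [Finset.sum_sub_distrib]
    abel

end Poincare

section Rectification

theorem isBigO_norm_pow_norm_pow {E : Type*} [SeminormedAddCommGroup E] {a b : ℕ} (hab : a ≤ b) :
    (fun x : E => ‖x‖ ^ b) =O[𝓝 0] fun x => ‖x‖ ^ a := by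
  have : (fun x : E => ‖x‖) =O[𝓝 0] fun _ => (1 : ℝ) :=
    continuous_norm.continuousAt.norm.isBoundedUnder_le.isBigO_one ℝ
  obtain ⟨d, rfl⟩ := Nat.exists_eq_add_of_le hab
  simpa [pow_add] using (isBigO_refl (fun x : E => ‖x‖ ^ a) (𝓝 0)).mul (this.pow d)

theorem ContinuousAt.isLittleO_clm_apply {𝕜 X E F : Type*} [NontriviallyNormedField 𝕜]
    [TopologicalSpace X] [NormedAddCommGroup E] [NormedSpace 𝕜 E] [NormedAddCommGroup F]
    [NormedSpace 𝕜 F] {T : X → E →L[𝕜] F} {x₀ : X} (hT : ContinuousAt T x₀) {φ : X → E}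
    {u : X → ℝ} (hφ : φ =o[𝓝 x₀] u) : (fun x => T x (φ x)) =o[𝓝 x₀] u := by
  have h1 : T =O[𝓝 x₀] fun _ => (1 : ℝ) := hT.norm.isBoundedUnder_le.isBigO_one ℝ
  have h2 : (fun x => ‖T x‖ * ‖φ x‖) =o[𝓝 x₀] fun x => 1 * u x :=
    h1.norm_left.mul_isLittleO hφ.norm_left
  simp only [one_mul] at h2
  refine (IsBigO.of_bound 1 (Filter.Eventually.of_forall fun x => ?_)).trans_isLittleO h2
  rw [one_mul, norm_mul, norm_norm, norm_norm]
  exact ContinuousLinearMap.le_opNorm _ _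

variable {E F : Type*} [NormedAddCommGroup E] [NormedSpace ℂ E]
  [NormedAddCommGroup F] [NormedSpace ℂ F]

/-- The Lie derivatives of a function along two vector fields commute up to the derivative along
the bracket. -/
theorem fderiv_fderiv_apply_sub {f : E → F} {X Y : E → E} {x : E} (hf : ContDiffAt ℂ 2 f x)
    (hX : DifferentiableAt ℂ X x) (hY : DifferentiableAt ℂ Y x) :
    fderiv ℂ (fun z => fderiv ℂ f z (Y z)) x (X x) - fderiv ℂ (fun z => fderiv ℂ f z (X z)) x (Y x)
      = fderiv ℂ f x (lieBracketVF X Y x) := by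
  have hd : DifferentiableAt ℂ (fderiv ℂ f) x :=
    (hf.fderiv_right (m := 1) (by norm_num)).differentiableAt (by norm_num)
  have hsymm : IsSymmSndFDerivAt ℂ f x := hf.isSymmSndFDerivAt (by simp)
  rw [fderiv_clm_apply hd hY, fderiv_clm_apply hd hX]
  simp only [lieBracketVF, add_apply, ContinuousLinearMap.comp_apply,
    ContinuousLinearMap.flip_apply, map_sub, hsymm (X x) (Y x)]
  abel

theorem isLittleO_fderiv_apply_sub {g : E → F} {X : E → E} {r : ℕ}
    (hg : ∀ᶠ x in 𝓝 0, DifferentiableAt ℂ g x) (hgo : g =o[𝓝 0] fun x => ‖x‖ ^ r)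
    (hX : DifferentiableAt ℂ X 0) :
    (fun x => fderiv ℂ g x (X x - X 0)) =o[𝓝 0] fun x => ‖x‖ ^ r := by
  have h1 : (fun x => X x - X 0) =O[𝓝 0] fun x => ‖x‖ := by
    simpa using hX.hasFDerivAt.isBigO_sub.norm_right
  refine IsBigO.trans_isLittleO ?_ (isLittleO_norm_mul_norm_fderiv hg hgo)
  have h2 : (fun x => ‖X x - X 0‖ * ‖fderiv ℂ g x‖) =O[𝓝 0]
      fun x => ‖x‖ * ‖fderiv ℂ g x‖ := h1.norm_left.mul (isBigO_refl _ _)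
  refine IsBigO.trans (IsBigO.of_bound 1 (Filter.Eventually.of_forall fun x => ?_)) h2
  rw [one_mul, norm_mul, norm_norm, norm_norm, mul_comm]
  exact ContinuousLinearMap.le_opNorm _ _

/-- Vector fields whose brackets vanish to order `k` are straightened to order `k + 1` by a
holomorphic map with prescribed derivative at `0`. -/
theorem exists_fderiv_apply_vectorField_sub_isLittleO [FiniteDimensional ℂ E] [CompleteSpace F]
    {ι : Type*} [Fintype ι] [DecidableEq ι] {X : ι → E → E} {k : ℕ}
    (hX : ∀ i, ∀ᶠ x in 𝓝 0, DifferentiableAt ℂ (X i) x)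
    (hbr : ∀ i j, lieBracketVF (X i) (X j) =o[𝓝 0] fun x => ‖x‖ ^ k)
    {ζ : ι → E →L[ℂ] ℂ} (hζ : ∀ i j, ζ i (X j 0) = if i = j then 1 else 0)
    (A : E →L[ℂ] F) {r : ℕ} (hr : r ≤ k + 1) :
    ∃ f : E → F, (∀ᶠ x in 𝓝 0, DifferentiableAt ℂ f x) ∧ f 0 = 0 ∧ HasFDerivAt f A 0 ∧
      ∀ i, (fun x => fderiv ℂ f x (X i x) - A (X i 0)) =o[𝓝 0] fun x => ‖x‖ ^ r := by
  induction r with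
  | zero =>
    refine ⟨A, Filter.Eventually.of_forall fun x => A.differentiableAt, map_zero A, A.hasFDerivAt,
      fun i => ?_⟩
    simp only [pow_zero, isLittleO_one_iff, ContinuousLinearMap.fderiv, ← map_sub]
    have hc : ContinuousAt (fun x => A (X i x - X i 0)) 0 :=
      A.continuous.continuousAt.comp
        ((hX i).self_of_nhds.continuousAt.sub continuousAt_const)
    simpa [ContinuousAt] using hc
  | succ r ih =>
    obtain ⟨f, hf, hf0, hfA, hfX⟩ := ih (by omega)
    set g : ι → E → F := fun i x => fderiv ℂ f x (X i x) - A (X i 0) with hg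
    have hf2 := eventually_contDiffAt_of_eventually_differentiableAt hf 2
    have hgd : ∀ i, ∀ᶠ x in 𝓝 0, DifferentiableAt ℂ (fun x => fderiv ℂ f x (X i x)) x := by
      intro i
      filter_upwards [hf2, hX i] with x h1 h2
      exact ((h1.fderiv_right (m := 1) (by norm_num)).differentiableAt (by norm_num)).clm_apply h2
    have hgd' : ∀ i, ∀ᶠ x in 𝓝 0, DifferentiableAt ℂ (g i) x := fun i =>
      (hgd i).mono fun x hx => hx.sub_const _
    have hgX := fun i j => isLittleO_fderiv_apply_sub (hgd' j) (hfX j) (hX i).self_of_nhds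
    have hclosed : ∀ i j, (fun x => fderiv ℂ (g j) x (X i 0) - fderiv ℂ (g i) x (X j 0))
        =o[𝓝 0] fun x => ‖x‖ ^ r := by
      intro i j
      have hb : (fun x => fderiv ℂ f x (lieBracketVF (X i) (X j) x)) =o[𝓝 0]
          fun x => ‖x‖ ^ r :=
        ContinuousAt.isLittleO_clm_apply
          (hf2.self_of_nhds.fderiv_right (m := 0) (by norm_num)).continuousAt
          ((hbr i j).trans_isBigO (isBigO_norm_pow_norm_pow (by omega)))
      refine ((hb.sub (hgX i j)).add (hgX j i)).congr' ?_ Filter.EventuallyEq.rfl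
      filter_upwards [hf2, hX i, hX j] with x h2 hi hj
      rw [← fderiv_fderiv_apply_sub h2 hi hj]
      simp only [hg, fderiv_sub_const, map_sub]
      abel
    obtain ⟨q, hq, hqo, hqX⟩ := exists_fderiv_apply_sub_isLittleO hζ hgd' hfX hclosed
    have hq0 : q 0 = 0 := by
      have := hqo.isBigO.eq_zero_imp.self_of_nhds
      simpa using this
    have hqA : HasFDerivAt q (0 : E →L[ℂ] F) 0 := by
      have h : q =o[𝓝 0] fun x : E => ‖x‖ := by
        simpa using hqo.trans_isBigO
          (isBigO_norm_pow_norm_pow (E := E) (show 1 ≤ r + 1 by omega))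
      rw [hasFDerivAt_iff_isLittleO_nhds_zero]
      simpa [hq0] using h.of_norm_right
    refine ⟨fun x => f x - q x, ?_, by simp [hf0, hq0], by simpa using hfA.fun_sub hqA, fun i => ?_⟩
    · filter_upwards [hf, hq] with x h1 h2 using h1.sub h2
    · refine ((hqX i).add (isLittleO_fderiv_apply_sub hq hqo (hX i).self_of_nhds)).neg_left.congr'
        ?_ Filter.EventuallyEq.rfl
      filter_upwards [hf, hq] with x h1 h2
      rw [fderiv_fun_sub h1 h2]
      simp only [hg, sub_apply, map_sub]
      abel

/-- An almost involutive family of independent vector fields can be replaced by a family with the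
same span whose brackets vanish to the same order. -/
theorem exists_span_eq_lieBracketVF_isLittleO [CompleteSpace E] {ι : Type*} [Fintype ι]
    [DecidableEq ι] {L : ι → E → E} (hL : ∀ i, ∀ᶠ x in 𝓝 0, DifferentiableAt ℂ (L i) x)
    {ζ : ι → E →L[ℂ] ℂ} (hζ : ∀ i j, ζ i (L j 0) = if i = j then 1 else 0)
    {c : ι → ι → ι → E → ℂ} {k : ℕ}
    (hbr : ∀ i j, (fun x => lieBracketVF (L i) (L j) x - ∑ s, c i j s x • L s x)
      =o[𝓝 0] fun x => ‖x‖ ^ k) :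
    ∃ X : ι → E → E, (∀ i, X i 0 = L i 0) ∧ (∀ i, ∀ᶠ x in 𝓝 0, DifferentiableAt ℂ (X i) x) ∧
      (∀ᶠ x in 𝓝 0, Submodule.span ℂ (Set.range fun i => X i x) =
        Submodule.span ℂ (Set.range fun i => L i x)) ∧
      ∀ i j, lieBracketVF (X i) (X j) =o[𝓝 0] fun x => ‖x‖ ^ k := by
  set P : E →L[ℂ] ι → ℂ := ContinuousLinearMap.pi ζ with hP
  set Φ : E → (ι → ℂ) →L[ℂ] E := fun x =>
    ∑ s, (ContinuousLinearMap.proj s : (ι → ℂ) →L[ℂ] ℂ).smulRight (L s x) with hΦ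
  have hΦa : ∀ x a, Φ x a = ∑ s, a s • L s x := fun x a => by simp [hΦ]
  have hΦ1 : ∀ x s, Φ x (Pi.single s 1) = L s x := fun x s => by
    simp [hΦa, Pi.single_apply]
  have hΦd : ∀ᶠ x in 𝓝 0, DifferentiableAt ℂ Φ x := by
    filter_upwards [Filter.eventually_all.2 hL] with x hx
    refine DifferentiableAt.fun_sum fun s _ => ?_
    exact ((ContinuousLinearMap.smulRightL ℂ (ι → ℂ) E
      (ContinuousLinearMap.proj s)).differentiableAt).comp x (hx s)
  set M : E → (ι → ℂ) →L[ℂ] ι → ℂ := fun x => P.comp (Φ x) with hM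
  have hM0 : M 0 = 1 := by
    refine ContinuousLinearMap.ext fun a => funext fun j => ?_
    simp [hM, hP, hΦa, hζ]
  have hMd : ∀ᶠ x in 𝓝 0, DifferentiableAt ℂ M x :=
    hΦd.mono fun x hx => (differentiableAt_const P).clm_comp hx
  have hMu : ∀ᶠ x in 𝓝 0, IsUnit (M x) := by
    refine hMd.self_of_nhds.continuousAt.eventually_mem (Units.isOpen.mem_nhds ?_)
    simp [hM0]
  set B : E → (ι → ℂ) →L[ℂ] ι → ℂ := fun x => Ring.inverse (M x) with hB
  have hBd : ∀ᶠ x in 𝓝 0, DifferentiableAt ℂ B x := by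
    filter_upwards [hMd, hMu] with x hx hu
    obtain ⟨u, hu⟩ := hu
    exact (differentiableAt_inverse (𝕜 := ℂ) ⟨u, hu⟩).comp x hx
  have hMB : ∀ᶠ x in 𝓝 0, ∀ a, M x (B x a) = a := hMu.mono fun x hx a => by
    rw [← mul_apply_eq_comp, Ring.mul_inverse_cancel _ hx, one_apply_eq_self]
  have hBM : ∀ᶠ x in 𝓝 0, ∀ a, B x (M x a) = a := hMu.mono fun x hx a => by
    rw [← mul_apply_eq_comp, Ring.inverse_mul_cancel _ hx, one_apply_eq_self]
  set b : ι → ι → E → ℂ := fun i s x => B x (Pi.single i 1) s with hb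
  have hbd : ∀ᶠ x in 𝓝 0, ∀ i s, DifferentiableAt ℂ (b i s) x := by
    filter_upwards [hBd] with x hx i s
    exact differentiableAt_pi.1 (hx.clm_apply (differentiableAt_const _)) s
  set X : ι → E → E := fun i x => ∑ s, b i s x • L s x with hX
  have hXΦ : ∀ i x, X i x = Φ x (B x (Pi.single i 1)) := fun i x => by rw [hΦa]
  have hXd : ∀ i, ∀ᶠ x in 𝓝 0, DifferentiableAt ℂ (X i) x := by
    intro i
    filter_upwards [hbd, Filter.eventually_all.2 hL] with x hbx hLx
    exact DifferentiableAt.fun_sum fun s _ => (hbx i s).smul (hLx s)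
  refine ⟨X, fun i => ?_, hXd, ?_, fun i j => ?_⟩
  · rw [hXΦ, hB]
    simp [hM0, hΦ1]
  · filter_upwards [hBM] with x hx
    refine le_antisymm (Submodule.span_le.2 ?_) (Submodule.span_le.2 ?_)
    · rintro _ ⟨i, rfl⟩
      exact Submodule.sum_mem _ fun s _ =>
        Submodule.smul_mem _ _ (Submodule.subset_span ⟨s, rfl⟩)
    · rintro _ ⟨s, rfl⟩
      have h1 : L s x = ∑ i, M x (Pi.single s 1) i • X i x := by
        calc L s x = Φ x (B x (M x (Pi.single s 1))) := by rw [hx, hΦ1]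
          _ = Φ x (B x (∑ i, M x (Pi.single s 1) i • Pi.single i (1 : ℂ))) := by
            congr 2
            ext i
            simp [Pi.single_apply]
          _ = _ := by simp only [map_sum, map_smul, hXΦ]
      simp only [SetLike.mem_coe]
      rw [h1]
      exact Submodule.sum_mem _ fun i _ =>
        Submodule.smul_mem _ _ (Submodule.subset_span ⟨i, rfl⟩)
  · set Q : E → E →L[ℂ] E := fun x => ContinuousLinearMap.id ℂ E - (Φ x).comp ((B x).comp P) with hQ
    have hQc : ContinuousAt Q 0 := by
      have h1 := hΦd.self_of_nhds.continuousAt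
      have h2 := hBd.self_of_nhds.continuousAt
      exact continuousAt_const.sub (h1.clm_comp (h2.clm_comp continuousAt_const))
    have hPX : ∀ i, ∀ᶠ x in 𝓝 0, P (X i x) = Pi.single i 1 := fun i => by
      filter_upwards [hMB] with x hx
      rw [hXΦ]
      exact hx _
    have hPD : ∀ i, ∀ᶠ x in 𝓝 0, ∀ h, P (fderiv ℂ (X i) x h) = 0 := fun i => by
      filter_upwards [(hPX i).eventually_nhds, hXd i] with x hx hd h
      have h1 : HasFDerivAt (fun y => P (X i y)) (P.comp (fderiv ℂ (X i) x)) x :=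
        P.hasFDerivAt.comp x hd.hasFDerivAt
      have h2 : HasFDerivAt (fun y => P (X i y)) (0 : E →L[ℂ] ι → ℂ) x :=
        (hasFDerivAt_const _ x).congr_of_eventuallyEq hx
      exact congrArg (fun T : E →L[ℂ] ι → ℂ => T h) (h1.unique h2)
    have hmain : (fun x => ∑ a, ∑ s, ((b i a x * b j s x) • Q x)
        (lieBracketVF (L a) (L s) x - ∑ l, c a s l x • L l x)) =o[𝓝 0] fun x => ‖x‖ ^ k := by
      refine IsLittleO.fun_sum fun a _ => IsLittleO.fun_sum fun s _ => ?_
      refine ContinuousAt.isLittleO_clm_apply ?_ (hbr a s)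
      exact (((hbd.self_of_nhds i a).continuousAt).mul
        (hbd.self_of_nhds j s).continuousAt).smul hQc
    refine hmain.congr' ?_ Filter.EventuallyEq.rfl
    filter_upwards [hBM, hbd, Filter.eventually_all.2 hL, hPD i, hPD j] with x hx hbx hLx hi hj
    have hQL : ∀ s, Q x (L s x) = 0 := fun s => by
      have : P (L s x) = M x (Pi.single s 1) := by simp [hM, hΦ1]
      simp [hQ, this, hx, hΦ1]
    have hQX : ∀ i' j', Q x (fderiv ℂ (X j') x (X i' x)) =
        ∑ a, ∑ s, (b i' a x * b j' s x) • Q x (fderiv ℂ (L s) x (L a x)) := by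
      intro i' j'
      have h1 : fderiv ℂ (X j') x =
          ∑ s, (b j' s x • fderiv ℂ (L s) x + (fderiv ℂ (b j' s) x).smulRight (L s x)) :=
        (HasFDerivAt.fun_sum fun s _ =>
          (hbx j' s).hasFDerivAt.smul (hLx s).hasFDerivAt).fderiv
      rw [h1, Finset.sum_comm]
      simp only [sum_apply, add_apply, smul_apply, ContinuousLinearMap.smulRight_apply, map_sum,
        map_add, map_smul, hQL, smul_zero, add_zero]
      refine Finset.sum_congr rfl fun s _ => ?_
      simp only [hX, map_sum, map_smul, Finset.smul_sum, smul_smul]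
      exact Finset.sum_congr rfl fun a _ => by rw [mul_comm]
    have hQid : Q x (lieBracketVF (X i) (X j) x) = lieBracketVF (X i) (X j) x := by
      simp [hQ, lieBracketVF, hi, hj]
    rw [← hQid, lieBracketVF, map_sub, hQX, hQX]
    rw [Finset.sum_comm (f := fun a s => (b j a x * b i s x) • Q x (fderiv ℂ (L s) x (L a x)))]
    rw [← Finset.sum_sub_distrib]
    refine Finset.sum_congr rfl fun a _ => ?_
    rw [← Finset.sum_sub_distrib]
    refine Finset.sum_congr rfl fun s _ => ?_
    rw [mul_comm (b j s x), ← smul_sub, smul_apply, map_sub, map_sum]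
    simp [hQL, lieBracketVF]

end Rectification

/-- Two linearly independent families with the same index type differ by an automorphism. -/
theorem LinearIndependent.exists_linearEquiv_apply_eq {K V ι : Type*} [DivisionRing K]
    [AddCommGroup V] [Module K V] [Finite ι] {v w : ι → V} (hv : LinearIndependent K v)
    (hw : LinearIndependent K w) : ∃ A : V ≃ₗ[K] V, ∀ i, A (v i) = w i := by
  have := FiniteDimensional.span_of_finite K (Set.finite_range v)
  obtain ⟨A, hA⟩ := Submodule.exists_linearEquiv_restrict_eq
    ((Module.Basis.span hv).equiv (Module.Basis.span hw) (Equiv.refl ι))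
  refine ⟨A, fun i => ?_⟩
  have h := hA (Module.Basis.span hv i)
  rw [Module.Basis.equiv_apply] at h
  simpa using h.symm

/-- A holomorphic map with invertible derivative at `a` is biholomorphic on an open neighborhood of
`a`, which can be chosen inside any given neighborhood. -/
theorem exists_openPartialHomeomorph_of_eventually_differentiableAt {E F : Type*}
    [NormedAddCommGroup E] [NormedSpace ℂ E] [FiniteDimensional ℂ E]
    [NormedAddCommGroup F] [NormedSpace ℂ F] [CompleteSpace F] {f : E → F} {a : E}
    (hf : ∀ᶠ x in 𝓝 a, DifferentiableAt ℂ f x) {A : E ≃L[ℂ] F}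
    (hA : HasFDerivAt f (A : E →L[ℂ] F) a) {S : Set E} (hS : S ∈ 𝓝 a) :
    ∃ e : OpenPartialHomeomorph E F, ⇑e = f ∧ a ∈ e.source ∧ e.source ⊆ S ∧
      DifferentiableOn ℂ e e.source ∧ DifferentiableOn ℂ e.symm e.target := by
  have : CompleteSpace E := FiniteDimensional.complete ℂ E
  have hf1 : ContDiffAt ℂ 1 f a :=
    (eventually_contDiffAt_of_eventually_differentiableAt hf 1).self_of_nhds
  have hinv : ∀ᶠ x in 𝓝 a, fderiv ℂ f x ∈ Set.range ((↑) : (E ≃L[ℂ] F) → E →L[ℂ] F) := by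
    refine (hf1.fderiv_right (m := 0) (by norm_num)).continuousAt.eventually_mem ?_
    rw [hA.fderiv]
    exact ContinuousLinearEquiv.nhds A
  obtain ⟨W, hW, hWo, haW⟩ := mem_nhds_iff.1 (Filter.inter_mem hS (hf.and hinv))
  set e₀ := hf1.toOpenPartialHomeomorph f hA one_ne_zero with he₀
  have hcoe : ⇑(e₀.restrOpen W hWo) = f := rfl
  refine ⟨e₀.restrOpen W hWo, hcoe, ⟨hf1.mem_toOpenPartialHomeomorph_source hA one_ne_zero, haW⟩,
    fun x hx => (hW hx.2).1, fun x hx => ?_, fun y hy => ?_⟩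
  · rw [hcoe]
    exact (hW hx.2).2.1.differentiableWithinAt
  · have hx := (e₀.restrOpen W hWo).map_target hy
    obtain ⟨-, hd, T, hT⟩ := hW hx.2
    refine ((e₀.restrOpen W hWo).hasFDerivAt_symm (f' := T) hy
      ?_).differentiableAt.differentiableWithinAt
    rw [hT]
    exact hd.hasFDerivAt

/-- Approximate holomorphic Frobenius theorem: if the holomorphic vector fields
`L₁, …, Lₙ` on a neighborhood of `0` in `ℂ^m` are pointwise linearly independent and
satisfy `[Lᵢ, Lⱼ](Z) = Σₛ cˢᵢⱼ(Z) Lₛ(Z) + o(|Z|^k)` with holomorphic `cˢᵢⱼ`, then there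
are holomorphic vector fields `L̃₁, …, L̃ₙ` spanning the same subspaces pointwise and a
local biholomorphic change of coordinates `Z̃` fixing `0` in which
`L̃ᵢ = ∂/∂Z̃ᵢ + o(|Z̃|^{k+1})`. -/
theorem approx_holomorphic_frobenius {m n k : ℕ} (hnm : n ≤ m)
    (U : Set (Fin m → ℂ)) (hU : IsOpen U) (hU0 : (0 : Fin m → ℂ) ∈ U)
    (L : Fin n → (Fin m → ℂ) → (Fin m → ℂ))
    (hLhol : ∀ i, DifferentiableOn ℂ (L i) U)
    (hLind : ∀ Z ∈ U, LinearIndependent ℂ (fun i => L i Z))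
    (c : Fin n → Fin n → Fin n → (Fin m → ℂ) → ℂ)
    (hchol : ∀ i j s, DifferentiableOn ℂ (c i j s) U)
    (hbracket : ∀ i j,
      (fun Z => lieBracketVF (L i) (L j) Z - ∑ s, c i j s Z • L s Z)
        =o[𝓝 0] fun Z : Fin m → ℂ => ‖Z‖ ^ k) :
    ∃ V : Set (Fin m → ℂ), IsOpen V ∧ (0 : Fin m → ℂ) ∈ V ∧ V ⊆ U ∧
    ∃ (Lt : Fin n → (Fin m → ℂ) → (Fin m → ℂ))
      (e : PartialHomeomorph (Fin m → ℂ) (Fin m → ℂ)),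
      (∀ i, DifferentiableOn ℂ (Lt i) V) ∧
      (∀ Z ∈ V, Submodule.span ℂ (Set.range fun i => Lt i Z)
          = Submodule.span ℂ (Set.range fun i => L i Z)) ∧
      e.source = V ∧ e 0 = 0 ∧
      DifferentiableOn ℂ (⇑e) V ∧ DifferentiableOn ℂ (⇑e.symm) e.target ∧
      ∀ i, (fun Z => fderiv ℂ (⇑e) Z (Lt i Z) - Pi.single (Fin.castLE hnm i) 1)
          =o[𝓝[V] 0] fun Z => ‖e Z‖ ^ (k + 1) := by
  have hL : ∀ i, ∀ᶠ x in 𝓝 0, DifferentiableAt ℂ (L i) x := fun i =>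
    (hLhol i).eventually_differentiableAt (hU.mem_nhds hU0)
  have hstd : LinearIndependent ℂ
      (fun i : Fin n => (Pi.single (Fin.castLE hnm i) 1 : Fin m → ℂ)) :=
    (Pi.linearIndependent_single_one (Fin m) ℂ).comp _ (Fin.castLE_injective hnm)
  obtain ⟨A₀, hA₀⟩ := (hLind 0 hU0).exists_linearEquiv_apply_eq hstd
  set A : (Fin m → ℂ) ≃L[ℂ] (Fin m → ℂ) := A₀.toContinuousLinearEquiv
  have hA : ∀ i, A (L i 0) = Pi.single (Fin.castLE hnm i) 1 := hA₀
  set ζ : Fin n → (Fin m → ℂ) →L[ℂ] ℂ := fun i =>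
    (ContinuousLinearMap.proj (Fin.castLE hnm i)).comp (A : (Fin m → ℂ) →L[ℂ] Fin m → ℂ)
  have hζ : ∀ i j, ζ i (L j 0) = if i = j then 1 else 0 := fun i j => by
    simp [ζ, hA, Pi.single_apply]
  obtain ⟨X, hX0, hXd, hXspan, hXbr⟩ := exists_span_eq_lieBracketVF_isLittleO hL hζ hbracket
  obtain ⟨f, hf, hf0, hfA, hfX⟩ := exists_fderiv_apply_vectorField_sub_isLittleO hXd hXbr
    (ζ := ζ) (by simpa only [hX0] using hζ) (A : (Fin m → ℂ) →L[ℂ] Fin m → ℂ) le_rfl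
  obtain ⟨e, hef, h0e, heS, hed, hed'⟩ := exists_openPartialHomeomorph_of_eventually_differentiableAt
    hf hfA (Filter.inter_mem (hU.mem_nhds hU0) (hXspan.and (Filter.eventually_all.2 hXd)))
  refine ⟨e.source, e.open_source, h0e, fun x hx => (heS hx).1, X, e.toPartialHomeomorph,
    fun i x hx => ((heS hx).2.2 i).differentiableWithinAt, fun x hx => (heS hx).2.1, rfl, ?_,
    hed, hed', fun i => ?_⟩
  · exact (congrFun hef 0).trans hf0
  · have he0 : e 0 = 0 := (congrFun hef 0).trans hf0
    have hsymm : (fun x => ‖x‖) =O[𝓝 0] fun x => ‖e x‖ := by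
      have h1 := (hed'.differentiableAt (e.open_target.mem_nhds (e.map_source h0e))).isBigO_sub
      have h2 := h1.comp_tendsto (e.continuousAt h0e)
      refine (h2.congr' ?_ ?_).norm_norm
      · filter_upwards [e.eventually_left_inverse h0e] with x hx
        simp [hx, e.left_inv h0e]
      · simp [he0, Function.comp_def]
    have h := ((hfX i).trans_isBigO (hsymm.pow (k + 1))).mono (nhdsWithin_le_nhds (s := e.source))
    simpa [hX0, hA, hef] using h
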